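/- In su_q^P(3) the deformed second-order Casimir function C_z^P = (1/z²)[sinh²(z(h₁+h₂−2h₃)/3) + sinh²(z(h₁+h₃−2h₂)/3) + sinh²(z(h₂+h₃−2h₁)/3)] + 2a₁₂a₂₁cosh(z(h₁+h₂−2h₃)/3) + 2a₂₃a₃₂cosh(z(h₂+h₃−2h₁)/3) + 2a₃₁a₁₃cosh(z(h₃+h₁−2h₂)/3) + 2z(a₁₂a₂₃a₃₁ + a₂₁a₃₂a₁₃)sinh(z(h₃+h₁−2h₂)/3) + 2z²a₁₂a₂₁a₃₂a₂₃cosh(z(h₃+h₁−2h₂)/3) is a Casimir: for every smooth function f : ℝ⁹ → ℝ, {C_z^P, f} = 0. -/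

import Mathlib

/-- Partial derivative of a function on ℝ⁹ in the `i`-th coordinate direction.
Coordinates: (x 0,…,x 8) = (h₁,h₂,h₃,a₁₂,a₂₁,a₂₃,a₃₂,a₁₃,a₃₁). -/
noncomputable def pd (i : Fin 9) (f : (Fin 9 → ℝ) → ℝ) (x : Fin 9 → ℝ) : ℝ :=
  fderiv ℝ f x (Pi.single i 1)

/-- The structure functions π(u,v) of su_q^P(3) for u < v (zero otherwise);
indices: 0=h₁, 1=h₂, 2=h₃, 3=a₁₂, 4=a₂₁, 5=a₂₃, 6=a₃₂, 7=a₁₃, 8=a₃₁. -/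
noncomputable def piU (z : ℝ) (u v : ℕ) (x : Fin 9 → ℝ) : ℝ :=
  match u, v with
  | 0, 3 => x 3
  | 0, 4 => -x 4
  | 0, 7 => x 7
  | 0, 8 => -x 8
  | 1, 3 => -x 3
  | 1, 4 => x 4
  | 1, 5 => x 5
  | 1, 6 => -x 6
  | 2, 5 => -x 5
  | 2, 6 => x 6
  | 2, 7 => -x 7
  | 2, 8 => x 8
  | 3, 4 => Real.sinh (z * (x 0 - x 1)) / z
  | 3, 5 => x 7
  | 3, 7 => z ^ 2 * x 3 ^ 2 * x 5
  | 3, 8 => -(Real.cosh (z * (x 0 - x 1)) * x 6)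
  | 4, 6 => -x 8
  | 4, 7 => Real.cosh (z * (x 0 - x 1)) * x 5
  | 4, 8 => -(z ^ 2 * x 4 ^ 2 * x 6)
  | 5, 6 => Real.sinh (z * (x 1 - x 2)) / z
  | 5, 7 => -(z ^ 2 * x 5 ^ 2 * x 3)
  | 5, 8 => Real.cosh (z * (x 1 - x 2)) * x 4
  | 6, 7 => -(Real.cosh (z * (x 1 - x 2)) * x 3)
  | 6, 8 => z ^ 2 * x 6 ^ 2 * x 4
  | 7, 8 => Real.sinh (z * (x 0 - x 2)) / z
      + z * Real.sinh (z * (x 0 - x 1)) * x 5 * x 6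
      + z * Real.sinh (z * (x 1 - x 2)) * x 3 * x 4
  | _, _ => 0

/-- The bracket of the q-Poisson algebra su_q^P(3):
{f,g} = Σ_{u<v} π(u,v)(∂_u f ∂_v g − ∂_v f ∂_u g). -/
noncomputable def suq3Bracket (z : ℝ) (f g : (Fin 9 → ℝ) → ℝ) (x : Fin 9 → ℝ) : ℝ :=
  ∑ u : Fin 9, ∑ v : Fin 9,
    if u < v then piU z u.val v.val x * (pd u f x * pd v g x - pd v f x * pd u g x)
    else 0

/-- The deformed second-order Casimir function C_z^P of su_q^P(3). -/
noncomputable def suq3Casimir2 (z : ℝ) (x : Fin 9 → ℝ) : ℝ :=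
  (1 / z ^ 2) *
    (Real.sinh (z * (x 0 + x 1 - 2 * x 2) / 3) ^ 2
     + Real.sinh (z * (x 0 + x 2 - 2 * x 1) / 3) ^ 2
     + Real.sinh (z * (x 1 + x 2 - 2 * x 0) / 3) ^ 2)
  + 2 * x 3 * x 4 * Real.cosh (z * (x 0 + x 1 - 2 * x 2) / 3)
  + 2 * x 5 * x 6 * Real.cosh (z * (x 1 + x 2 - 2 * x 0) / 3)
  + 2 * x 8 * x 7 * Real.cosh (z * (x 2 + x 0 - 2 * x 1) / 3)
  + 2 * z * (x 3 * x 5 * x 8 + x 4 * x 6 * x 7) * Real.sinh (z * (x 2 + x 0 - 2 * x 1) / 3)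
  + 2 * z ^ 2 * x 3 * x 4 * x 6 * x 5 * Real.cosh (z * (x 2 + x 0 - 2 * x 1) / 3)

/-- The gradient of `suq3Casimir2`, in terms of the weights `A`, `B`, `C` at which its hyperbolic
functions are evaluated. -/
noncomputable def suq3CasimirGradient (z A B C : ℝ) (x : Fin 9 → ℝ) : Fin 9 → ℝ :=
  let wA := 2 * Real.sinh A * Real.cosh A / z + 2 * z * x 3 * x 4 * Real.sinh A
  let wB := 2 * Real.sinh B * Real.cosh B / z + 2 * z * x 5 * x 6 * Real.sinh B
  let wC := 2 * Real.sinh C * Real.cosh C / z + 2 * z * x 8 * x 7 * Real.sinh C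
    + 2 * z ^ 2 * (x 3 * x 5 * x 8 + x 4 * x 6 * x 7) * Real.cosh C
    + 2 * z ^ 3 * x 3 * x 4 * x 6 * x 5 * Real.sinh C
  ![(wA - 2 * wB + wC) / 3,
    (wA + wB - 2 * wC) / 3,
    (-2 * wA + wB + wC) / 3,
    2 * x 4 * Real.cosh A + 2 * z * x 5 * x 8 * Real.sinh C
      + 2 * z ^ 2 * x 4 * x 6 * x 5 * Real.cosh C,
    2 * x 3 * Real.cosh A + 2 * z * x 6 * x 7 * Real.sinh C
      + 2 * z ^ 2 * x 3 * x 6 * x 5 * Real.cosh C,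
    2 * x 6 * Real.cosh B + 2 * z * x 3 * x 8 * Real.sinh C
      + 2 * z ^ 2 * x 3 * x 4 * x 6 * Real.cosh C,
    2 * x 5 * Real.cosh B + 2 * z * x 4 * x 7 * Real.sinh C
      + 2 * z ^ 2 * x 3 * x 4 * x 5 * Real.cosh C,
    2 * x 8 * Real.cosh C + 2 * z * x 4 * x 6 * Real.sinh C,
    2 * x 7 * Real.cosh C + 2 * z * x 3 * x 5 * Real.sinh C]

theorem pd_suq3Casimir2 {z : ℝ} (hz : z ≠ 0) (x : Fin 9 → ℝ) (i : Fin 9) :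
    pd i (suq3Casimir2 z) x =
      suq3CasimirGradient z (z * (x 0 + x 1 - 2 * x 2) / 3) (z * (x 1 + x 2 - 2 * x 0) / 3)
        (z * (x 2 + x 0 - 2 * x 1) / 3) x i := by
  have p (j : Fin 9) := hasFDerivAt_apply (𝕜 := ℝ) j x
  have weight (j k l : Fin 9) :=
    ((((p j).add (p k)).sub ((p l).const_mul 2)).const_mul z).mul_const (3⁻¹ : ℝ)
  have hA := weight 0 1 2
  have hB := weight 1 2 0
  have hC' := weight 0 2 1
  have hC := weight 2 0 1
  have key := ((((((((hA.sinh.pow 2).add (hC'.sinh.pow 2)).add (hB.sinh.pow 2)).const_mul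
    (1 / z ^ 2)).add ((((p 3).const_mul 2).mul (p 4)).mul hA.cosh)).add
    ((((p 5).const_mul 2).mul (p 6)).mul hB.cosh)).add
    ((((p 8).const_mul 2).mul (p 7)).mul hC.cosh)).add
    ((((((p 3).mul (p 5)).mul (p 8)).add (((p 4).mul (p 6)).mul (p 7))).const_mul
      (2 * z)).mul hC.sinh)).add
    (((((((p 3).const_mul (2 * z ^ 2)).mul (p 4)).mul (p 6)).mul (p 5))).mul hC.cosh)
  have hderiv : HasFDerivAt (suq3Casimir2 z) _ x := key
  rw [pd, hderiv.fderiv]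
  have hswap : x 0 + x 2 - 2 * x 1 = x 2 + x 0 - 2 * x 1 := by ring
  fin_cases i <;>
    · simp [suq3CasimirGradient, ← div_eq_mul_inv, hswap]
      try field_simp
      try ring

/-- C_z^P is a Casimir function of su_q^P(3). -/
theorem suq3_casimir2 (z : ℝ) (hz : z ≠ 0)
    (f : (Fin 9 → ℝ) → ℝ) (hf : ContDiff ℝ (⊤ : ℕ∞) f) :
    ∀ x : Fin 9 → ℝ, suq3Bracket z (suq3Casimir2 z) f x = 0 := by
  intro x
  simp only [suq3Bracket, pd_suq3Casimir2 hz]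
  generalize hB : z * (x 1 + x 2 - 2 * x 0) / 3 = B
  generalize hC : z * (x 2 + x 0 - 2 * x 1) / 3 = C
  have hA : z * (x 0 + x 1 - 2 * x 2) / 3 = -(B + C) := by rw [← hB, ← hC]; ring
  have h01 : z * (x 0 - x 1) = C - B := by rw [← hB, ← hC]; ring
  have h12 : z * (x 1 - x 2) = -(B + C) - C := by rw [← hB, ← hC]; ring
  have h02 : z * (x 0 - x 2) = -(B + C) - B := by rw [← hB, ← hC]; ring
  simp [Fin.sum_univ_succ, piU, suq3CasimirGradient, hA, h01, h12, h02, Real.sinh_sub,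
    Real.cosh_sub, Real.sinh_add, Real.cosh_add]
  rw [Real.cosh_eq B, Real.sinh_eq B, Real.cosh_eq C, Real.sinh_eq C, Real.exp_neg, Real.exp_neg]
  have hb := Real.exp_ne_zero B
  have hc := Real.exp_ne_zero C
  generalize Real.exp B = b at *
  generalize Real.exp C = c at *
  field_simp
  ring
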